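/- In a K4-free bridged graph with star St(z), let u and v belong to two 2-neighboring cones F(x) and F(y), and let F(w) be the panel 1-neighboring both cones, with T = ∂*F(w). If u' and v' denote the entrances of u and v on T, then d_G(u,v) ≤ d_G(u,u') + d_T(u',v') + d_G(v',v) ≤ 4·d_G(u,v). -/

import Mathlib

open SimpleGraph

variable {V : Type*}

/-- The metric interval between `u` and `v`. -/
def interval (G : SimpleGraph V) (u v : V) : Set V :=
  {w | G.dist u w + G.dist w v = G.dist u v}

/-- Triangle condition (TC). -/
def TriangleCondition (G : SimpleGraph V) : Prop :=
  ∀ (k : ℕ) (u v w : V), G.dist u v = k + 1 → G.dist u w = k + 1 → G.Adj v w →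
    ∃ x, G.dist u x = k ∧ G.Adj x v ∧ G.Adj x w

/-- Quadrangle condition (QC). -/
def QuadrangleCondition (G : SimpleGraph V) : Prop :=
  ∀ (k : ℕ) (u v w z : V), G.dist u v = k + 1 → G.dist u w = k + 1 →
    G.dist u z = k + 2 → G.Adj v z → G.Adj w z →
    ∃ x, G.dist u x = k ∧ G.Adj x v ∧ G.Adj x w

def WeaklyModular (G : SimpleGraph V) : Prop :=
  TriangleCondition G ∧ QuadrangleCondition G

/-- No induced 4-cycle. -/
def NoInducedC4 (G : SimpleGraph V) : Prop :=
  ¬ ∃ a b c d : V, G.Adj a b ∧ G.Adj b c ∧ G.Adj c d ∧ G.Adj d a ∧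
    a ≠ c ∧ b ≠ d ∧ ¬ G.Adj a c ∧ ¬ G.Adj b d

/-- No induced 5-cycle. -/
def NoInducedC5 (G : SimpleGraph V) : Prop :=
  ¬ ∃ a b c d e : V, G.Adj a b ∧ G.Adj b c ∧ G.Adj c d ∧ G.Adj d e ∧ G.Adj e a ∧
    a ≠ c ∧ a ≠ d ∧ b ≠ d ∧ b ≠ e ∧ c ≠ e ∧
    ¬ G.Adj a c ∧ ¬ G.Adj a d ∧ ¬ G.Adj b d ∧ ¬ G.Adj b e ∧ ¬ G.Adj c e

/-- Bridged graph: weakly modular with no induced `C₄` or `C₅`. -/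
def Bridged (G : SimpleGraph V) : Prop :=
  WeaklyModular G ∧ NoInducedC4 G ∧ NoInducedC5 G

/-- No clique on four vertices. -/
def K4Free (G : SimpleGraph V) : Prop :=
  ¬ ∃ a b c d : V, G.Adj a b ∧ G.Adj a c ∧ G.Adj a d ∧ G.Adj b c ∧ G.Adj b d ∧ G.Adj c d

/-- Closed neighborhood `N[z]`. -/
def closedNbhd (G : SimpleGraph V) (z : V) : Set V := insert z (G.neighborSet z)

/-- Metric projection of `u` on a set `A`. -/
def mproj (G : SimpleGraph V) (u : V) (A : Set V) : Set V :=
  {a ∈ A | ∀ b ∈ A, G.dist u a ≤ G.dist u b}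

/-- The star `St(z)`: `N[z]` together with all vertices outside `N[z]` having two
adjacent neighbors in `N[z]`. -/
def starSet (G : SimpleGraph V) (z : V) : Set V :=
  closedNbhd G z ∪
    {u | u ∉ closedNbhd G z ∧ ∃ y y', G.Adj y y' ∧ G.Adj z y ∧ G.Adj z y' ∧ G.Adj u y ∧ G.Adj u y'}

/-- The panel of a neighbor `x` of `z`: vertices with unique projection `x` on `N[z]`. -/
def panelFiber (G : SimpleGraph V) (z x : V) : Set V :=
  {u | mproj G u (closedNbhd G z) = {x}}

/-- The cone of a vertex `x` at distance 2 from `z` in `St(z)`. -/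
def coneFiber (G : SimpleGraph V) (z x : V) : Set V :=
  {u | ∃ y y', y ≠ y' ∧ G.Adj y y' ∧ G.Adj z y ∧ G.Adj z y' ∧ G.Adj x y ∧ G.Adj x y' ∧
    mproj G u (closedNbhd G z) = {y, y'} ∧ G.dist u x + 1 = G.dist u y}

/-- The fiber of `x ∈ St(z)`: a panel if `x ~ z`, a cone otherwise. -/
def fiberSet (G : SimpleGraph V) (z x : V) : Set V :=
  {u | (G.Adj x z ∧ u ∈ panelFiber G z x) ∨ (¬ G.Adj x z ∧ u ∈ coneFiber G z x)}

/-- Total boundary of a fiber `F`: the vertices of `F` with a neighbor outside `F`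
(i.e. in another fiber of the partition). -/
def totalBoundary (G : SimpleGraph V) (F : Set V) : Set V :=
  {u ∈ F | ∃ v, G.Adj u v ∧ v ∉ F}

/-- `S` is starshaped with respect to `x`. -/
def StarshapedWrt (G : SimpleGraph V) (x : V) (S : Set V) : Prop :=
  ∀ s ∈ S, interval G x s ⊆ S

/-- `S` is a starshaped tree rooted at `x`: intervals to the root are contained in `S`
and each non-root vertex has a unique neighbor towards the root. -/
def StarshapedTree (G : SimpleGraph V) (x : V) (S : Set V) : Prop :=
  x ∈ S ∧ (∀ s ∈ S, interval G x s ⊆ S) ∧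
    (∀ s ∈ S, s ≠ x → ∃! w, w ∈ interval G s x ∧ G.Adj s w)

/-- The tree obtained as the union of the branches of a starshaped tree `S` rooted
at `x`: its edges are the edges of `G` lying consecutively on some branch. -/
def branchTree (G : SimpleGraph V) (x : V) (S : Set V) : SimpleGraph V :=
  SimpleGraph.fromRel (fun u v => G.Adj u v ∧ u ∈ S ∧ v ∈ S ∧
    ∃ s ∈ S, u ∈ interval G x s ∧ v ∈ interval G x s ∧ G.dist x v = G.dist x u + 1)

/-- Metric triangle. -/
def MetricTriangle (G : SimpleGraph V) (u1 u2 u3 : V) : Prop :=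
  interval G u1 u2 ∩ interval G u2 u3 = {u2} ∧
  interval G u2 u3 ∩ interval G u3 u1 = {u3} ∧
  interval G u3 u1 ∩ interval G u1 u2 = {u1}

/-! ### Metric facts about bridged graphs -/

theorem dist_le_succ_of_adj {G : SimpleGraph V} (hc : G.Connected) (o : V) {a b : V}
    (h : G.Adj a b) : G.dist o a ≤ G.dist o b + 1 := by
  have h1 := hc.dist_triangle (u := o) (v := b) (w := a)
  rwa [dist_eq_one_iff_adj.2 h.symm] at h1

theorem exists_adj_dist_eq {G : SimpleGraph V} (hc : G.Connected) {s t : V} {n : ℕ}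
    (h : G.dist s t = n + 1) : ∃ q, G.Adj s q ∧ G.dist q t = n := by
  obtain ⟨p, hp⟩ := hc.exists_walk_length_eq_dist s t
  rw [h] at hp
  cases p with
  | nil => simp at hp
  | @cons _ q _ hq p =>
    refine ⟨q, hq, ?_⟩
    have h1 := dist_le p
    have h2 := dist_le_succ_of_adj hc t hq
    rw [dist_comm, dist_comm (u := t)] at h2
    simp only [Walk.length_cons] at hp
    omega

/-- Two neighbors of `s` that are both closer to `o` than `s` are adjacent. -/
theorem adj_of_parents {G : SimpleGraph V} (hc : G.Connected) (hb : Bridged G) {o s p q : V}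
    (hp : G.Adj s p) (hq : G.Adj s q) (hop : G.dist o p + 1 = G.dist o s)
    (hoq : G.dist o q + 1 = G.dist o s) (hpq : p ≠ q) : G.Adj p q := by
  by_contra hn
  cases hk : G.dist o p with
  | zero =>
    have h1 := hc.dist_eq_zero_iff.1 hk
    have h2 : G.dist o q = 0 := by omega
    exact hpq (h1.symm.trans (hc.dist_eq_zero_iff.1 h2))
  | succ k =>
    obtain ⟨c, hc1, hcp, hcq⟩ := hb.1.2 k o p q s hk (by omega) (by omega) hp.symm hq.symm
    refine hb.2.1 ⟨s, p, c, q, hp, hcp.symm, hcq, hq.symm, ?_, hpq, ?_, hn⟩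
    · rintro rfl; omega
    · intro h
      have := dist_le_succ_of_adj hc o h
      omega

/-- Adjacent vertices equidistant from `o` have a common neighbor closer to `o`. -/
theorem exists_common_parent {G : SimpleGraph V} (hc : G.Connected) (hb : Bridged G)
    {o a b : V} (h : G.Adj a b) (hab : G.dist o a = G.dist o b) :
    ∃ c, G.dist o c + 1 = G.dist o a ∧ G.Adj c a ∧ G.Adj c b := by
  cases hk : G.dist o a with
  | zero =>
    exact absurd ((hc.dist_eq_zero_iff.1 hk).symm.trans
      (hc.dist_eq_zero_iff.1 (hab ▸ hk))) h.ne
  | succ k =>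
    obtain ⟨c, h1, h2, h3⟩ := hb.1.1 k o a b hk (by omega) h
    exact ⟨c, by omega, h2, h3⟩

/-- Distances from `o` cannot rise and then fall below the peak along a geodesic. -/
theorem no_peak {G : SimpleGraph V} (hc : G.Connected) (hb : Bridged G) (o t : V) :
    ∀ (n : ℕ) (a q : V), G.dist q t = n → G.Adj a q → G.dist a t = n + 1 →
      G.dist o a < G.dist o q → G.dist o t < G.dist o q → False := by
  intro n
  induction n with
  | zero =>
    intro a q hq _ _ _ ht
    rw [hc.dist_eq_zero_iff.1 hq] at ht
    omega
  | succ n ih =>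
    intro a q hq haq hat hoa hot
    obtain ⟨r, hqr, hr⟩ := exists_adj_dist_eq hc hq
    have h1 := dist_le_succ_of_adj hc o haq.symm
    have h2 := dist_le_succ_of_adj hc o hqr
    have h3 := dist_le_succ_of_adj hc o hqr.symm
    have har : ¬ G.Adj a r := fun h => by
      have := dist_le_succ_of_adj hc t h
      rw [dist_comm, dist_comm (u := t)] at this
      omega
    have hne : a ≠ r := by rintro rfl; omega
    rcases lt_trichotomy (G.dist o r) (G.dist o q) with hlt | heq | hgt
    · exact har (adj_of_parents (o := o) hc hb haq.symm hqr (by omega) (by omega) hne)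
    · obtain ⟨c, hoc, hcq, hcr⟩ := exists_common_parent hc hb hqr heq.symm
      have hac : a ≠ c := by rintro rfl; exact har hcr
      have hadj := adj_of_parents (o := o) hc hb haq.symm hcq.symm (by omega) hoc hac
      refine ih c r hr hcr ?_ (by omega) (by omega)
      have e1 := dist_le_succ_of_adj hc t hadj
      have e2 := dist_le_succ_of_adj hc t hcr
      rw [dist_comm (u := t), dist_comm (u := t)] at e1 e2
      omega
    · exact ih q r hr hqr (by omega) (by omega) (by omega)

/-- Balls of a bridged graph are convex. -/
theorem ball_convex {G : SimpleGraph V} (hc : G.Connected) (hb : Bridged G) (o : V) {s t q : V}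
    (hq : q ∈ interval G s t) : G.dist o q ≤ max (G.dist o s) (G.dist o t) := by
  obtain ⟨k, hk⟩ : ∃ k, G.dist s q = k := ⟨_, rfl⟩
  induction k generalizing s with
  | zero => rw [hc.dist_eq_zero_iff.1 hk]; exact le_max_left _ _
  | succ k ih =>
    by_contra! hlt
    rw [max_lt_iff] at hlt
    obtain ⟨r, hsr, hr⟩ := exists_adj_dist_eq hc hk
    simp only [interval, Set.mem_ofPred_eq] at hq ih
    have h1 := dist_le_succ_of_adj hc t hsr
    rw [dist_comm (u := t), dist_comm (u := t)] at h1
    have h2 := hc.dist_triangle (u := r) (v := q) (w := t)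
    have h3 := ih (s := r) (by omega) hr
    rcases le_max_iff.1 h3 with h3 | h3
    · exact no_peak hc hb o t (G.dist r t) s r rfl hsr (by omega) (by omega) (by omega)
    · omega

/-- If `t` is closer to `o` than `s`, some neighbor of `s` is closer to both `o` and `t`. -/
theorem exists_parent_toward {G : SimpleGraph V} (hc : G.Connected) (hb : Bridged G) (o t : V) :
    ∀ (n : ℕ) (s : V), G.dist s t = n → G.dist o t < G.dist o s →
      ∃ p, G.Adj s p ∧ G.dist o p + 1 = G.dist o s ∧ G.dist p t + 1 = n := by
  intro n
  induction n with
  | zero =>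
    intro s hs hlt
    rw [hc.dist_eq_zero_iff.1 hs] at hlt
    omega
  | succ n ih =>
    intro s hs hlt
    obtain ⟨q, hsq, hq⟩ := exists_adj_dist_eq hc hs
    have h0 := ball_convex hc hb o (s := s) (t := t) (q := q)
      (by simp only [interval, Set.mem_ofPred_eq]; rw [dist_eq_one_iff_adj.2 hsq]; omega)
    rw [max_eq_left hlt.le] at h0
    have h1 := dist_le_succ_of_adj hc o hsq
    rcases h0.lt_or_eq with h0 | h0
    · exact ⟨q, hsq, by omega, by omega⟩
    · obtain ⟨p, hqp, hop, hpt⟩ := ih q hq (by omega)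
      obtain ⟨r, hor, hrs, hrq⟩ := exists_common_parent hc hb hsq h0.symm
      have e2 := dist_le_succ_of_adj hc t hrs.symm
      rw [dist_comm (u := t), dist_comm (u := t)] at e2
      refine ⟨r, hrs.symm, hor, ?_⟩
      by_cases hrp : r = p
      · subst hrp; omega
      · have hadj := adj_of_parents (o := o) hc hb hrq.symm hqp (by omega) hop hrp
        have e1 := dist_le_succ_of_adj hc t hadj
        rw [dist_comm (u := t), dist_comm (u := t)] at e1
        omega

/-- Distinct vertices equidistant from `o` can be moved simultaneously towards `o`, getting
closer to each other. -/
theorem exists_parents_closer {G : SimpleGraph V} (hc : G.Connected) (hb : Bridged G) (o s : V) :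
    ∀ (n : ℕ) (t : V), G.dist t s = n → t ≠ s → G.dist o s = G.dist o t →
      ∃ p q, G.Adj s p ∧ G.Adj t q ∧ G.dist o p + 1 = G.dist o s ∧
        G.dist o q + 1 = G.dist o t ∧ G.dist p q + 1 ≤ n := by
  intro n
  induction n with
  | zero => intro t ht hne; exact absurd (hc.dist_eq_zero_iff.1 ht) hne
  | succ n ih =>
    intro t ht hne hst
    obtain ⟨r, htr, hr⟩ := exists_adj_dist_eq hc ht
    have h0 := ball_convex hc hb o (s := t) (t := s) (q := r)
      (by simp only [interval, Set.mem_ofPred_eq]; rw [dist_eq_one_iff_adj.2 htr]; omega)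
    rw [hst, max_self] at h0
    have h1 := dist_le_succ_of_adj hc o htr
    rcases h0.lt_or_eq with h0 | h0
    · obtain ⟨p, hsp, hp⟩ := exists_adj_dist_eq hc (s := s) (t := o) (n := G.dist o r)
        (by rw [dist_comm]; omega)
      rw [dist_comm] at hp
      refine ⟨p, r, hsp, htr, by omega, by omega, ?_⟩
      have h2 := dist_le_succ_of_adj hc r hsp.symm
      rw [dist_comm (u := r), dist_comm (u := r) (v := s), dist_comm (u := s), hr] at h2
      by_contra! hlt
      have h3 := ball_convex hc hb o (s := p) (t := r) (q := s) (by
        simp only [interval, Set.mem_ofPred_eq]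
        rw [dist_eq_one_iff_adj.2 hsp.symm, dist_comm (u := s), hr]; omega)
      rw [hp, max_self] at h3
      omega
    · obtain ⟨c, hoc, hct, hcr⟩ := exists_common_parent hc hb htr h0.symm
      by_cases hrs : r = s
      · subst hrs
        exact ⟨c, c, hcr.symm, hct.symm, by omega, by omega, by simp⟩
      · obtain ⟨p, q, hsp, hrq, hp, hq, hpq⟩ := ih r hr hrs (by omega)
        refine ⟨p, c, hsp, hct.symm, hp, hoc, ?_⟩
        by_cases hcq : c = q
        · subst hcq; omega
        · have hadj := adj_of_parents (o := o) hc hb hcr.symm hrq (by omega) hq hcq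
          have := dist_le_succ_of_adj hc p hadj
          omega

/-- The intervals from `o` to `u` and `v` meet at distance at most `d(u, v)` from `u` and `v`. -/
theorem exists_meet {G : SimpleGraph V} (hc : G.Connected) (hb : Bridged G) (o : V) :
    ∀ (n : ℕ) (u v : V), G.dist u v ≤ n →
      ∃ t ∈ interval G o u, t ∈ interval G o v ∧ G.dist t u ≤ n ∧ G.dist t v ≤ n := by
  simp only [interval, Set.mem_ofPred_eq]
  intro n
  induction n with
  | zero =>
    intro u v h
    obtain rfl := hc.dist_eq_zero_iff.1 (Nat.le_zero.1 h)
    exact ⟨u, by simp⟩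
  | succ n ih =>
    have key : ∀ a p t : V, G.Adj a p → G.dist o p + 1 = G.dist o a →
        G.dist o t + G.dist t p = G.dist o p → G.dist t p ≤ n →
        G.dist o t + G.dist t a = G.dist o a ∧ G.dist t a ≤ n + 1 := by
      intro a p t h1 h2 h3 h4
      have e1 := dist_le_succ_of_adj hc t h1
      have e2 := hc.dist_triangle (u := o) (v := t) (w := a)
      omega
    intro u v h
    rcases lt_trichotomy (G.dist o u) (G.dist o v) with hlt | heq | hgt
    · obtain ⟨p, h1, h2, h3⟩ := exists_parent_toward hc hb o u _ v rfl hlt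
      rw [dist_comm (u := v), dist_comm (u := p)] at h3
      obtain ⟨t, t1, t2, t3, t4⟩ := ih u p (by omega)
      obtain ⟨k1, k2⟩ := key v p t h1 h2 t2 t4
      exact ⟨t, t1, k1, by omega, k2⟩
    · by_cases hvu : v = u
      · subst hvu
        exact ⟨v, by simp⟩
      · obtain ⟨p, q, h1, h2, h3, h4, h5⟩ :=
          exists_parents_closer hc hb o u _ v rfl hvu heq
        rw [dist_comm (u := v)] at h5
        obtain ⟨t, t1, t2, t3, t4⟩ := ih p q (by omega)
        obtain ⟨k1, k2⟩ := key u p t h1 h3 t1 t3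
        obtain ⟨k3, k4⟩ := key v q t h2 h4 t2 t4
        exact ⟨t, k1, k3, k2, k4⟩
    · obtain ⟨p, h1, h2, h3⟩ := exists_parent_toward hc hb o v _ u rfl hgt
      obtain ⟨t, t1, t2, t3, t4⟩ := ih p v (by omega)
      obtain ⟨k1, k2⟩ := key u p t h1 h2 t1 t3
      exact ⟨t, k1, t2, k2, by omega⟩

theorem exists_shadow_of_parent {G : SimpleGraph V} (hc : G.Connected) (hb : Bridged G) (o t : V) :
    ∀ (k : ℕ) (u p : V), G.dist u t = k + 1 → G.Adj u p → G.dist o p + 1 = G.dist o u →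
      G.dist o t + G.dist t u = G.dist o u →
      ∃ r, G.dist o r + G.dist r p = G.dist o p ∧ G.dist o r = G.dist o t ∧ G.dist t r ≤ 1 := by
  intro k
  induction k with
  | zero =>
    intro u p hut hup hop hot
    rw [dist_comm] at hut
    have hadj := (dist_eq_one_iff_adj.1 hut).symm
    refine ⟨p, by simp, by omega, ?_⟩
    by_cases h : t = p
    · simp [h]
    · exact (dist_eq_one_iff_adj.2
        (adj_of_parents (o := o) hc hb hadj hup (by omega) hop h)).le
  | succ k ih =>
    intro u p hut hup hop hot
    obtain ⟨y, huy, hy⟩ := exists_adj_dist_eq hc hut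
    rw [dist_comm] at hut
    have hy' : G.dist t y = k + 1 := by rw [dist_comm]; exact hy
    have h1 := dist_le_succ_of_adj hc o huy
    have h2 := hc.dist_triangle (u := o) (v := t) (w := y)
    by_cases hyp : y = p
    · subst hyp
      exact ⟨t, by omega, rfl, by simp⟩
    · have hadj := adj_of_parents (o := o) hc hb huy hup (by omega) hop hyp
      obtain ⟨c, hoc, hcy, hcp⟩ := exists_common_parent hc hb hadj (o := o) (by omega)
      obtain ⟨r, r1, r2, r3⟩ := ih y c hy hcy.symm hoc (by omega)
      have e1 := dist_le_succ_of_adj hc r hcp.symm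
      have e2 := hc.dist_triangle (u := o) (v := r) (w := p)
      exact ⟨r, by omega, r2, r3⟩

/-- Two geodesics from `u` towards `o` diverge only during the first steps: if `p` is on one
of them, the other one stays within `d(u, p)` of an extension of the first. -/
theorem exists_shadow {G : SimpleGraph V} (hc : G.Connected) (hb : Bridged G) (o p : V) :
    ∀ (m : ℕ) (u t : V), G.dist u p = m → p ∈ interval G o u → t ∈ interval G o u →
      G.dist o t ≤ G.dist o p →
      ∃ r ∈ interval G o p, G.dist o r = G.dist o t ∧ G.dist t r ≤ m := by
  simp only [interval, Set.mem_ofPred_eq]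
  intro m
  induction m with
  | zero =>
    intro u t hup hp ht htp
    obtain rfl := hc.dist_eq_zero_iff.1 hup
    exact ⟨t, ht, rfl, by simp⟩
  | succ m ih =>
    intro u t hup hp ht htp
    obtain ⟨y, huy, hy⟩ := exists_adj_dist_eq hc hup
    rw [dist_comm] at hup
    have hy' : G.dist p y = m := by rw [dist_comm]; exact hy
    have h1 := dist_le_succ_of_adj hc o huy
    have h2 := hc.dist_triangle (u := o) (v := p) (w := y)
    obtain ⟨r, r1, r2, r3⟩ := exists_shadow_of_parent hc hb o t (G.dist t u - 1) u y
      (by rw [dist_comm]; omega) huy (by omega) ht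
    obtain ⟨σ, s1, s2, s3⟩ := ih y r hy (by omega) r1 (by omega)
    have := hc.dist_triangle (u := t) (v := r) (w := σ)
    exact ⟨σ, s1, by omega, by omega⟩

/-- In a `K₄`-free bridged graph no triangle is equidistant from a vertex. -/
theorem no_equidistant_triangle {G : SimpleGraph V} (hc : G.Connected) (hb : Bridged G)
    (hk4 : K4Free G) (o : V) :
    ∀ (h : ℕ) (a b c : V), G.Adj a b → G.Adj b c → G.Adj c a →
      G.dist o a = h → G.dist o b = h → G.dist o c = h → False := by
  intro h
  induction h with
  | zero =>
    intro a b c hab _ _ ha hb' _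
    exact hab.ne ((hc.dist_eq_zero_iff.1 ha).symm.trans (hc.dist_eq_zero_iff.1 hb'))
  | succ h ih =>
    intro a b c hab hbc hca ha hb' hc'
    obtain ⟨r, hr, hra, hrb⟩ := hb.1.1 h o a b ha hb' hab
    obtain ⟨s, hs, hsb, hsc⟩ := hb.1.1 h o b c hb' hc' hbc
    obtain ⟨t, ht, htc, hta⟩ := hb.1.1 h o c a hc' ha hca
    have hrs : r ≠ s := by rintro rfl; exact hk4 ⟨r, a, b, c, hra, hrb, hsc, hab, hca.symm, hbc⟩
    have hst : s ≠ t := by rintro rfl; exact hk4 ⟨s, a, b, c, hta, hsb, hsc, hab, hca.symm, hbc⟩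
    have htr : t ≠ r := by rintro rfl; exact hk4 ⟨t, a, b, c, hta, hrb, htc, hab, hca.symm, hbc⟩
    exact ih r s t (adj_of_parents (o := o) hc hb hrb.symm hsb.symm (by omega) (by omega) hrs)
      (adj_of_parents (o := o) hc hb hsc.symm htc.symm (by omega) (by omega) hst)
      (adj_of_parents (o := o) hc hb hta.symm hra.symm (by omega) (by omega) htr) hr hs ht

/-! ### Panels and cones around a neighbor `w` of the center `z` -/

/-- `x` is the base of a cone whose vertices have `w` among their two projections on `N[z]`. -/
def IsConeBase (G : SimpleGraph V) (z w x : V) : Prop :=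
  ¬ G.Adj x z ∧ x ≠ z ∧ G.Adj x w ∧ ∃ a, G.Adj x a ∧ G.Adj a w ∧ G.Adj a z

theorem mem_panelFiber_iff {G : SimpleGraph V} (hc : G.Connected) {z w p : V}
    (hwz : G.Adj w z) : p ∈ panelFiber G z w ↔
      G.dist z p = G.dist w p + 1 ∧ ∀ a, G.Adj a z → a ≠ w → G.dist w p < G.dist a p := by
  have hz := dist_le_succ_of_adj hc p hwz.symm
  have hmem : ∀ b, b ∈ closedNbhd G z ↔ b = z ∨ G.Adj b z := fun b => by
    simp only [closedNbhd, Set.mem_insert_iff, mem_neighborSet, G.adj_comm z]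
  simp only [panelFiber, mproj, Set.ext_iff, Set.mem_ofPred_eq, Set.mem_singleton_iff, hmem,
    dist_comm (u := p)]
  simp only [dist_comm (u := p)] at hz
  constructor
  · intro h
    have hw := ((h w).2 rfl).2
    have hlt : ∀ b, (b = z ∨ G.Adj b z) → b ≠ w → G.dist w p < G.dist b p := by
      intro b hb hbw
      by_contra! hle
      exact hbw ((h b).1 ⟨hb, fun c hc => hle.trans (hw c hc)⟩)
    refine ⟨?_, fun a ha => hlt a (.inr ha)⟩
    have := hlt z (.inl rfl) hwz.ne'
    omega
  · rintro ⟨h1, h2⟩ b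
    constructor
    · rintro ⟨hb, hmin⟩
      by_contra hbw
      have h3 := hmin w (.inr hwz)
      rcases hb with rfl | hb
      · omega
      · have := h2 b hb hbw
        omega
    · rintro rfl
      refine ⟨.inr hwz, ?_⟩
      rintro c (rfl | hcz)
      · omega
      · by_cases h : c = b
        · rw [h]
        · exact (h2 c hcz h).le

/-- A vertex having `w` as a projection on `N[z]` and lying outside the panel of `w` has a second
projection. -/
theorem exists_second_projection {G : SimpleGraph V} (hc : G.Connected) (hb : Bridged G)
    {z w p : V} (hwz : G.Adj w z) (hp : G.dist z p = G.dist w p + 1)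
    (hn : p ∉ panelFiber G z w) :
    ∃ a, G.Adj a z ∧ G.Adj a w ∧ G.dist a p = G.dist w p := by
  rw [mem_panelFiber_iff hc hwz] at hn
  push Not at hn
  obtain ⟨a, haz, haw, hle⟩ := hn hp
  have h1 := dist_le_succ_of_adj hc p haz.symm
  simp only [dist_comm (u := p)] at h1
  refine ⟨a, haz, ?_, by omega⟩
  refine adj_of_parents (o := p) hc hb haz.symm hwz.symm ?_ ?_ haw <;>
    simp only [dist_comm (u := p)] <;> omega

theorem exists_isConeBase {G : SimpleGraph V} (hc : G.Connected) (hb : Bridged G)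
    {z w p : V} (hwz : G.Adj w z) (hp : G.dist z p = G.dist w p + 1)
    (hn : p ∉ panelFiber G z w) :
    ∃ x, IsConeBase G z w x ∧ G.dist x p + 1 = G.dist w p := by
  obtain ⟨a, haz, haw, hap⟩ := exists_second_projection hc hb hwz hp hn
  obtain ⟨x, hx, hxa, hxw⟩ := exists_common_parent (o := p) hc hb haw
    (by simp only [dist_comm (u := p)]; omega)
  simp only [dist_comm (u := p)] at hx
  refine ⟨x, ⟨fun h => ?_, ?_, hxw, a, hxa, haw, haz⟩, by omega⟩
  · have h1 := dist_le_succ_of_adj hc p h.symm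
    simp only [dist_comm (u := p)] at h1
    omega
  · rintro rfl
    omega

theorem notMem_panelFiber {G : SimpleGraph V} (hc : G.Connected) {z w x p : V}
    (hwz : G.Adj w z) (hx : IsConeBase G z w x) (hxp : G.dist x p + 1 = G.dist w p) :
    p ∉ panelFiber G z w := by
  rw [mem_panelFiber_iff hc hwz]
  rintro ⟨-, h⟩
  obtain ⟨-, -, -, a, hxa, haw, haz⟩ := hx
  have h1 := h a haz haw.ne
  have h2 := dist_le_succ_of_adj hc p hxa.symm
  simp only [dist_comm (u := p)] at h2
  omega

theorem IsConeBase.not_adj {G : SimpleGraph V} (hb : Bridged G) (hk4 : K4Free G) {z w x y : V}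
    (hwz : G.Adj w z) (hx : IsConeBase G z w x) (hy : IsConeBase G z w y) : ¬ G.Adj x y := by
  obtain ⟨hxz, hxz', hxw, a, hxa, haw, haz⟩ := hx
  obtain ⟨hyz, hyz', hyw, b, hyb, hbw, hbz⟩ := hy
  intro hxy
  have hxb : ¬ G.Adj x b := fun h => hk4 ⟨w, x, y, b, hxw.symm, hyw.symm, hbw.symm, hxy, h, hyb⟩
  have hya : ¬ G.Adj y a := fun h => hk4 ⟨w, x, y, a, hxw.symm, hyw.symm, haw.symm, hxy, hxa, h⟩
  have hba : ¬ G.Adj b a := fun h => hk4 ⟨w, z, b, a, hwz, hbw.symm, haw.symm, hbz.symm, haz.symm, h⟩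
  refine hb.2.2 ⟨x, y, b, z, a, hxy, hyb, hbz, haz.symm, hxa.symm, ?_, hxz', hyz', ?_, ?_,
    hxb, hxz, hyz, hya, hba⟩
  · rintro rfl; exact hxz hbz
  · rintro rfl; exact hyz haz
  · rintro rfl; exact hya hyb

theorem IsConeBase.eq {G : SimpleGraph V} (hc : G.Connected) (hb : Bridged G) (hk4 : K4Free G)
    {z w x y p : V} (hwz : G.Adj w z) (hx : IsConeBase G z w x) (hy : IsConeBase G z w y)
    (hxp : G.dist x p + 1 = G.dist w p) (hyp : G.dist y p + 1 = G.dist w p) : x = y := by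
  by_contra hne
  refine hx.not_adj hb hk4 hwz hy ?_
  refine adj_of_parents (o := p) hc hb hx.2.2.1.symm hy.2.2.1.symm ?_ ?_ hne <;>
    simpa only [dist_comm (u := p)]

theorem dist_center_of_mem_interval {G : SimpleGraph V} (hc : G.Connected) {z w u s : V}
    (hwz : G.Adj w z) (hu : G.dist z u = G.dist w u + 1) (hs : s ∈ interval G w u) :
    G.dist z s = G.dist w s + 1 := by
  simp only [interval, Set.mem_ofPred_eq] at hs
  have h1 := dist_le_succ_of_adj hc s hwz.symm
  simp only [dist_comm (u := s)] at h1
  have h2 := hc.dist_triangle (u := z) (v := s) (w := u)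
  omega

/-- Moving from a vertex of a cone towards `w`, one stays in the cone or enters the panel. -/
theorem mem_panelFiber_or_of_mem_interval {G : SimpleGraph V} (hc : G.Connected)
    (hb : Bridged G) (hk4 : K4Free G) {z w x u s : V}
    (hwz : G.Adj w z) (hx : IsConeBase G z w x) (hu : G.dist z u = G.dist w u + 1)
    (hxu : G.dist x u + 1 = G.dist w u) (hs : s ∈ interval G w u) :
    s ∈ panelFiber G z w ∨ G.dist x s + 1 = G.dist w s := by
  have hz := dist_center_of_mem_interval hc hwz hu hs
  by_cases hp : s ∈ panelFiber G z w
  · exact .inl hp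
  · obtain ⟨y, hy, hys⟩ := exists_isConeBase hc hb hwz hz hp
    simp only [interval, Set.mem_ofPred_eq] at hs
    have h1 := hc.dist_triangle (u := y) (v := s) (w := u)
    have h2 := dist_le_succ_of_adj hc u hy.2.2.1.symm
    simp only [dist_comm (u := u)] at h2
    obtain rfl := hx.eq hc hb hk4 hwz hy hxu (by omega)
    exact .inr hys

theorem panelFiber_starshaped {G : SimpleGraph V} (hc : G.Connected) {z w s t : V}
    (hwz : G.Adj w z) (hs : s ∈ panelFiber G z w) (ht : t ∈ interval G w s) :
    t ∈ panelFiber G z w := by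
  rw [mem_panelFiber_iff hc hwz] at hs ⊢
  refine ⟨dist_center_of_mem_interval hc hwz hs.1 ht, fun a haz haw => ?_⟩
  simp only [interval, Set.mem_ofPred_eq] at ht
  have h1 := hs.2 a haz haw
  have h2 := hc.dist_triangle (u := a) (v := t) (w := s)
  omega

theorem dist_of_center_parent {G : SimpleGraph V} (hc : G.Connected) {z w s g : V}
    (hwz : G.Adj w z) (hs : s ∈ panelFiber G z w) (hne : s ≠ w) (hsg : G.Adj s g)
    (hg : G.dist z g + 1 = G.dist z s) : G.dist w g + 1 = G.dist w s := by
  rw [mem_panelFiber_iff hc hwz] at hs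
  have hpos := hc.pos_dist_of_ne hne.symm
  obtain ⟨a, hza, ha⟩ := exists_adj_dist_eq hc (s := z) (t := g) (n := G.dist w s - 1) (by omega)
  have h1 := dist_le_succ_of_adj hc a hsg
  by_cases h : a = w
  · subst h; omega
  · have := hs.2 a hza.symm h
    omega

/-- A boundary vertex of a panel has a neighbor in a cone at the same distance from `w`. -/
theorem exists_cone_neighbor {G : SimpleGraph V} (hc : G.Connected) (hb : Bridged G)
    {z w s : V} (hwz : G.Adj w z) (hs : s ∈ totalBoundary G (panelFiber G z w)) (hne : s ≠ w) :
    ∃ q, G.Adj s q ∧ G.dist w q = G.dist w s ∧ G.dist z q = G.dist w q + 1 ∧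
      q ∉ panelFiber G z w := by
  obtain ⟨hs, q, hsq, hq⟩ := hs
  have hs' := (mem_panelFiber_iff hc hwz).1 hs
  have hpos := hc.pos_dist_of_ne hne.symm
  have noFlat : ∀ r, G.Adj s r → G.dist z r = G.dist z s → G.dist w r ≤ G.dist w s := by
    intro r hsr hr
    obtain ⟨g, hg, hgs, hgr⟩ := exists_common_parent hc hb hsr hr.symm
    have h1 := dist_of_center_parent hc hwz hs hne hgs.symm hg
    have h2 := dist_le_succ_of_adj hc w hgr.symm
    omega
  have bounds : ∀ r, G.Adj s r → G.dist w r ≤ G.dist w s + 1 ∧ G.dist w s ≤ G.dist w r + 1 ∧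
      G.dist z r ≤ G.dist z s + 1 ∧ G.dist z s ≤ G.dist z r + 1 ∧
      G.dist z r ≤ G.dist w r + 1 := by
    intro r hsr
    have h := dist_le_succ_of_adj hc r hwz.symm
    simp only [dist_comm (u := r)] at h
    exact ⟨dist_le_succ_of_adj hc w hsr.symm, dist_le_succ_of_adj hc w hsr,
      dist_le_succ_of_adj hc z hsr.symm, dist_le_succ_of_adj hc z hsr, h⟩
  have bq := bounds q hsq
  rcases lt_trichotomy (G.dist z q) (G.dist z s) with hlt | heq | hgt
  · have h1 := dist_of_center_parent hc hwz hs hne hsq (by omega)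
    refine absurd (panelFiber_starshaped hc hwz hs ?_) hq
    simp only [interval, Set.mem_ofPred_eq, dist_eq_one_iff_adj.2 hsq.symm]
    exact h1
  · have := noFlat q hsq heq
    exact ⟨q, hsq, by omega, by omega, hq⟩
  · obtain ⟨a, haz, haw, haq⟩ := exists_second_projection hc hb hwz (by omega) hq
    have h1 := hs'.2 a haz haw.ne
    have h2 := dist_le_succ_of_adj hc s haw
    simp only [dist_comm (u := s)] at h2
    obtain ⟨r, hr, hrs, hrq⟩ := exists_common_parent (o := a) hc hb hsq (by omega)
    have br := bounds r hrs.symm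
    have h3 := dist_le_succ_of_adj hc r haz.symm
    simp only [dist_comm (u := r)] at h3
    have h4 := dist_le_succ_of_adj hc z hrq.symm
    have h5 := noFlat r hrs.symm (by omega)
    refine ⟨r, hrs.symm, by omega, by omega, fun h => ?_⟩
    have := ((mem_panelFiber_iff hc hwz).1 h).2 a haz haw.ne
    omega

/-- A boundary vertex of the panel of `w` has a unique neighbor closer to `w`, which is again a
boundary vertex. -/
theorem existsUnique_parent_boundary {G : SimpleGraph V} (hc : G.Connected) (hb : Bridged G)
    (hk4 : K4Free G) {z w s : V} (hwz : G.Adj w z)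
    (hs : s ∈ totalBoundary G (panelFiber G z w)) (hne : s ≠ w) :
    ∃ r ∈ totalBoundary G (panelFiber G z w),
      ∀ r', G.Adj s r' → G.dist w r' + 1 = G.dist w s → r' = r := by
  obtain ⟨q, hsq, hwq, hzq, hq⟩ := exists_cone_neighbor hc hb hwz hs hne
  obtain ⟨r, hr, hrs, hrq⟩ := exists_common_parent (o := w) hc hb hsq hwq.symm
  obtain ⟨a, haz, haw, haq⟩ := exists_second_projection hc hb hwz hzq hq
  have has := ((mem_panelFiber_iff hc hwz).1 hs.1).2 a haz haw.ne
  have key : ∀ t, G.Adj s t → G.dist w t + 1 = G.dist w s →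
      t ∈ panelFiber G z w ∧ G.dist a t + 1 = G.dist a s := by
    intro t hst ht
    have hm : t ∈ panelFiber G z w := by
      refine panelFiber_starshaped hc hwz hs.1 ?_
      simp only [interval, Set.mem_ofPred_eq, dist_eq_one_iff_adj.2 hst.symm]
      exact ht
    have h1 := ((mem_panelFiber_iff hc hwz).1 hm).2 a haz haw.ne
    have h2 := dist_le_succ_of_adj hc t haw
    have h3 := dist_le_succ_of_adj hc s haw
    simp only [dist_comm (u := t), dist_comm (u := s)] at h2 h3
    exact ⟨hm, by omega⟩
  have kr := key r hrs.symm hr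
  refine ⟨r, ⟨kr.1, q, hrq, hq⟩, fun r' hsr' hr' => ?_⟩
  have kr' := key r' hsr' hr'
  by_contra hne'
  have h1 := adj_of_parents (o := w) hc hb hrs.symm hsr' hr hr' (Ne.symm hne')
  have h2 : G.Adj q r' := by
    refine adj_of_parents (o := a) hc hb hsq hsr' ?_ kr'.2 ?_
    · have := dist_le_succ_of_adj hc a hsq
      omega
    · rintro rfl
      omega
  exact hk4 ⟨s, q, r, r', hsq, hrs.symm, hsr', hrq.symm, h2, h1⟩

/-- The total boundary of a panel is starshaped with respect to `w`. -/
theorem totalBoundary_starshaped {G : SimpleGraph V} (hc : G.Connected) (hb : Bridged G)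
    (hk4 : K4Free G) {z w : V} (hwz : G.Adj w z) :
    StarshapedWrt G w (totalBoundary G (panelFiber G z w)) := by
  intro s hs t ht
  obtain ⟨k, hk⟩ : ∃ k, G.dist s t = k := ⟨_, rfl⟩
  induction k generalizing s with
  | zero => rwa [← hc.dist_eq_zero_iff.1 hk]
  | succ k ih =>
    obtain ⟨q, hsq, hq⟩ := exists_adj_dist_eq hc hk
    simp only [interval, Set.mem_ofPred_eq] at ht ih
    rw [dist_comm] at hk
    have hq' : G.dist t q = k := by rw [dist_comm]; exact hq
    have h1 := dist_le_succ_of_adj hc w hsq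
    have h2 := hc.dist_triangle (u := w) (v := t) (w := q)
    obtain ⟨r, hr, hu⟩ := existsUnique_parent_boundary hc hb hk4 hwz hs
      (by rintro rfl; rw [dist_self] at ht; omega)
    obtain rfl := hu q hsq (by omega)
    exact ih q hr (by omega) hq

/-- Distinct cones around `w` contain no adjacent vertices equidistant from `w`. -/
theorem IsConeBase.eq_of_adj {G : SimpleGraph V} (hc : G.Connected) (hb : Bridged G)
    (hk4 : K4Free G) {z w x y p q : V} (hwz : G.Adj w z)
    (hx : IsConeBase G z w x) (hy : IsConeBase G z w y)
    (hzp : G.dist z p = G.dist w p + 1) (hzq : G.dist z q = G.dist w q + 1)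
    (hxp : G.dist x p + 1 = G.dist w p) (hyq : G.dist y q + 1 = G.dist w q)
    (hpq : G.Adj p q) (hw : G.dist w p = G.dist w q) : x = y := by
  have memI : ∀ {r s : V}, G.Adj r s → G.dist w r + 1 = G.dist w s → r ∈ interval G w s := by
    intro r s hrs hr
    simpa only [interval, Set.mem_ofPred_eq, dist_eq_one_iff_adj.2 hrs]
  have conePar : ∀ {x p : V}, IsConeBase G z w x → G.dist z p = G.dist w p + 1 →
      G.dist x p + 1 = G.dist w p → G.dist x p ≠ 0 →
      ∃ p', G.Adj p' p ∧ G.dist w p' + 1 = G.dist w p ∧ G.dist x p' + 1 = G.dist w p' := by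
    intro x p hx hzp hxp h0
    obtain ⟨p', hpp', hp'⟩ := exists_adj_dist_eq hc (s := p) (t := x) (n := G.dist x p - 1)
      (by rw [dist_comm]; omega)
    rw [dist_comm] at hp'
    have h1 := dist_le_succ_of_adj hc w hpp'
    have h2 := dist_le_succ_of_adj hc p' hx.2.2.1.symm
    simp only [dist_comm (u := p')] at h2
    exact ⟨p', hpp'.symm, by omega, by omega⟩
  by_cases h0 : G.dist x p = 0
  · obtain rfl := hc.dist_eq_zero_iff.1 h0
    obtain rfl := hc.dist_eq_zero_iff.1 (show G.dist y q = 0 by omega)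
    exact absurd hpq (hx.not_adj hb hk4 hwz hy)
  obtain ⟨r, hr, hrp, hrq⟩ := exists_common_parent (o := w) hc hb hpq hw
  by_contra hne
  have hrF : r ∈ panelFiber G z w := by
    rcases mem_panelFiber_or_of_mem_interval hc hb hk4 hwz hx hzp hxp (memI hrp hr) with h1 | h1
    · exact h1
    rcases mem_panelFiber_or_of_mem_interval hc hb hk4 hwz hy hzq hyq
      (memI hrq (by omega)) with h2 | h2
    · exact h2
    exact absurd (hx.eq hc hb hk4 hwz hy h1 h2) hne
  obtain ⟨p', hp'p, hwp', hxp'⟩ := conePar hx hzp hxp h0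
  obtain ⟨q', hq'q, hwq', hyq'⟩ := conePar hy hzq hyq (by omega)
  have hrp' : r ≠ p' := by rintro rfl; exact notMem_panelFiber hc hwz hx hxp' hrF
  have hrq' : r ≠ q' := by rintro rfl; exact notMem_panelFiber hc hwz hy hyq' hrF
  have arp : G.Adj r p' := adj_of_parents (o := w) hc hb hrp.symm hp'p.symm hr hwp' hrp'
  have arq : G.Adj r q' :=
    adj_of_parents (o := w) hc hb hrq.symm hq'q.symm (by omega) hwq' hrq'
  obtain ⟨c, hwc, hcr, hcp⟩ := exists_common_parent (o := w) hc hb arp (by omega)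
  obtain ⟨d, hwd, hdr, hdq⟩ := exists_common_parent (o := w) hc hb arq (by omega)
  obtain ⟨e, -, he⟩ := existsUnique_parent_boundary hc hb hk4 hwz
    ⟨hrF, p, hrp, notMem_panelFiber hc hwz hx hxp⟩ (by rintro rfl; simp at hwc)
  obtain rfl : c = d := (he c hcr.symm hwc).trans (he d hdr.symm hwd).symm
  have hpq' : ¬ G.Adj p' q := fun h => by
    rcases mem_panelFiber_or_of_mem_interval hc hb hk4 hwz hy hzq hyq
      (memI h (by omega)) with h2 | h2
    · exact notMem_panelFiber hc hwz hx hxp' h2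
    · exact hne (hx.eq hc hb hk4 hwz hy hxp' h2)
  have hqp' : ¬ G.Adj p q' := fun h => by
    rcases mem_panelFiber_or_of_mem_interval hc hb hk4 hwz hx hzp hxp
      (memI h.symm (by omega)) with h2 | h2
    · exact notMem_panelFiber hc hwz hy hyq' h2
    · exact hne (hx.eq hc hb hk4 hwz hy h2 hyq')
  have hp'q' : ¬ G.Adj p' q' := fun h =>
    no_equidistant_triangle hc hb hk4 w _ r p' q' arp h arq.symm rfl (by omega) (by omega)
  have farAdj : ∀ {t}, G.dist w t = G.dist w p → ¬ G.Adj c t := fun ht h => by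
    have := dist_le_succ_of_adj hc w h.symm
    omega
  refine hb.2.2 ⟨c, p', p, q, q', hcp, hp'p, hpq, hq'q.symm, hdq.symm, ?_, ?_, ?_, ?_, ?_,
    farAdj rfl, farAdj hw.symm, hpq', hp'q', hqp'⟩
  · rintro rfl; omega
  · rintro rfl; omega
  · rintro rfl; omega
  · rintro rfl; exact hne (hx.eq hc hb hk4 hwz hy hxp' hyq')
  · rintro rfl; omega

/-- Along a path at constant distance `h` from `w`, no vertex of which spans three consecutive
vertices from below, the distance to `z` cannot drop from `h + 1` to `h` and return to `h + 1`. -/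
theorem no_dip_in_row {G : SimpleGraph V} (hc : G.Connected) (hb : Bridged G) (hk4 : K4Free G)
    {z w : V} (hwz : G.Adj w z) (h n : ℕ) (p : ℕ → V) (hn : 2 ≤ n)
    (hw : ∀ k ≤ n, G.dist w (p k) = h) (hp : ∀ k < n, G.Adj (p k) (p (k + 1)))
    (htriple : ∀ k c, k + 2 ≤ n → G.Adj c (p k) → G.Adj c (p (k + 1)) → G.Adj c (p (k + 2)) →
      G.dist w c + 1 ≠ h)
    (h0 : G.dist z (p 0) = h + 1) (h1 : G.dist z (p 1) = h) (hlast : G.dist z (p n) = h + 1) :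
    False := by
  induction h generalizing n p with
  | zero =>
    have e0 := hc.dist_eq_zero_iff.1 (hw 0 (by omega))
    have e1 := hc.dist_eq_zero_iff.1 (hw 1 (by omega))
    exact (hp 0 (by omega)).ne (e0.symm.trans e1)
  | succ h ih =>
    have hs : ∀ k, ∃ s, k < n → G.dist w s = h ∧ G.Adj s (p k) ∧ G.Adj s (p (k + 1)) := by
      intro k
      by_cases hk : k < n
      · obtain ⟨s, hs, hs1, hs2⟩ := exists_common_parent (o := w) hc hb (hp k hk)
          ((hw k hk.le).trans (hw (k + 1) hk).symm)
        have := hw k hk.le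
        exact ⟨s, fun _ => ⟨by omega, hs1, hs2⟩⟩
      · exact ⟨w, fun hk' => absurd hk' hk⟩
    choose s hs using hs
    have hne : ∀ k, k + 2 ≤ n → s k ≠ s (k + 1) := by
      intro k hk heq
      have a := hs k (by omega)
      have b := hs (k + 1) (by omega)
      exact htriple k (s k) hk a.2.1 a.2.2 (heq ▸ b.2.2) (by omega)
    have hadj : ∀ k, k + 2 ≤ n → G.Adj (s k) (s (k + 1)) := by
      intro k hk
      have a := hs k (by omega)
      have b := hs (k + 1) (by omega)
      have := hw (k + 1) (by omega)
      exact adj_of_parents (o := w) (s := p (k + 1)) hc hb a.2.2.symm b.2.1.symm (by omega)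
        (by omega) (hne k hk)
    have upper : ∀ k < n, G.dist z (s k) ≤ h + 1 := by
      intro k hk
      have := dist_le_succ_of_adj hc (s k) hwz.symm
      simp only [dist_comm (u := s k)] at this
      have := (hs k hk).1
      omega
    have z0 : G.dist z (s 0) = h + 1 := by
      have := upper 0 (by omega)
      have := dist_le_succ_of_adj hc z (hs 0 (by omega)).2.1.symm
      omega
    have z1 : G.dist z (s 1) = h := by
      have a := hs 0 (by omega)
      have b := hs 1 (by omega)
      have hu := upper 1 (by omega)
      have hl := dist_le_succ_of_adj hc z b.2.1.symm
      by_contra hz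
      exact no_equidistant_triangle hc hb hk4 z (h + 1) (p 1) (s 0) (s 1) a.2.2.symm
        (hadj 0 hn) b.2.1 h1 z0 (by omega)
    have zl : G.dist z (s (n - 1)) = h + 1 := by
      have a := (hs (n - 1) (by omega)).2.2
      rw [show n - 1 + 1 = n by omega] at a
      have := upper (n - 1) (by omega)
      have := dist_le_succ_of_adj hc z a.symm
      omega
    have hn2 : n ≠ 2 := by
      rintro rfl
      simp only [Nat.add_one_sub_one] at zl
      omega
    refine ih (n - 1) s (by omega) (fun k hk => (hs k (by omega)).1)
      (fun k hk => hadj k (by omega)) ?_ z0 z1 zl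
    intro k c hk c0 c1 c2 hwc
    have a := hs k (by omega)
    have b := hs (k + 2) (by omega)
    have far : ∀ j ≤ n, ¬ G.Adj c (p j) ∧ c ≠ p j := by
      intro j hj
      have := hw j hj
      refine ⟨fun h => ?_, by rintro rfl; omega⟩
      have := dist_le_succ_of_adj hc w h.symm
      omega
    have sk : ¬ G.Adj (s k) (p (k + 2)) := fun h =>
      htriple k (s k) (by omega) a.2.1 a.2.2 h (by omega)
    have sk2 : ¬ G.Adj (p (k + 1)) (s (k + 2)) := fun h =>
      htriple (k + 1) (s (k + 2)) (by omega) h.symm b.2.1 b.2.2 (by omega)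
    have neS : ∀ i < n, ∀ j ≤ n, s i ≠ p j := by
      intro i hi j hj heq
      have h1 := (hs i hi).1
      have h2 := hw j hj
      rw [heq] at h1
      omega
    refine hb.2.2 ⟨c, s k, p (k + 1), p (k + 2), s (k + 2), c0, a.2.2, hp (k + 1) (by omega),
      b.2.1.symm, c2.symm, (far _ (by omega)).2, (far _ (by omega)).2, neS _ (by omega) _ (by omega),
      ?_, (neS _ (by omega) _ (by omega)).symm, (far _ (by omega)).1, (far _ (by omega)).1, sk,
      fun h => hk4 ⟨c, s k, s (k + 1), s (k + 2), c0, c1, c2, hadj k (by omega), h,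
        hadj (k + 1) (by omega)⟩, sk2⟩
    intro heq
    exact sk (heq ▸ b.2.1)

theorem exists_geodesic {G : SimpleGraph V} (hc : G.Connected) (n : ℕ) (u v : V)
    (h : G.dist u v = n) : ∃ q : ℕ → V, q 0 = u ∧ q n = v ∧
      (∀ k < n, G.Adj (q k) (q (k + 1))) ∧ ∀ k ≤ n, G.dist (q k) v = n - k := by
  induction n generalizing u with
  | zero => exact ⟨fun _ => u, rfl, hc.dist_eq_zero_iff.1 h, by simp, by simpa using h⟩
  | succ n ih =>
    obtain ⟨u', huu', hu'⟩ := exists_adj_dist_eq hc h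
    obtain ⟨q, q0, qn, qa, qd⟩ := ih u' hu'
    refine ⟨fun k => Nat.casesOn k u q, rfl, qn, ?_, ?_⟩
    · rintro (_ | k) hk
      · simpa [q0]
      · exact qa k (by omega)
    · rintro (_ | k) hk
      · simpa
      · simpa using qd k (by omega)

/-- A geodesic through vertices equidistant from `w` joining vertices of two distinct cones meets
the panel of `w`. -/
theorem exists_mem_panelFiber_of_row {G : SimpleGraph V} (hc : G.Connected) (hb : Bridged G)
    (hk4 : K4Free G) {z w x y u v : V} (hwz : G.Adj w z) (hx : IsConeBase G z w x)
    (hy : IsConeBase G z w y) (hxy : x ≠ y)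
    (hzu : G.dist z u = G.dist w u + 1) (hxu : G.dist x u + 1 = G.dist w u)
    (hzv : G.dist z v = G.dist w v + 1) (hyv : G.dist y v + 1 = G.dist w v)
    (hrow : ∀ t ∈ interval G u v, G.dist w t = G.dist w u) :
    ∃ t ∈ panelFiber G z w, t ∈ interval G u v := by
  obtain ⟨n, hn⟩ : ∃ n, G.dist u v = n := ⟨_, rfl⟩
  obtain ⟨q, q0, qn, qa, qd⟩ := exists_geodesic hc n u v hn
  have qu : ∀ k ≤ n, G.dist u (q k) ≤ k := by
    intro k
    induction k with
    | zero => simp [q0]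
    | succ k ih =>
      intro hk
      have := dist_le_succ_of_adj hc u (qa k hk).symm
      have := ih (by omega)
      omega
  have qI : ∀ k ≤ n, q k ∈ interval G u v := by
    intro k hk
    have h1 := qu k hk
    have h2 := qd k hk
    have h3 := hc.dist_triangle (u := u) (v := q k) (w := v)
    simp only [interval, Set.mem_ofPred_eq]
    omega
  by_contra! hno
  have hplus : ∀ k ≤ n, G.dist z (q k) = G.dist w (q k) + 1 := by
    by_contra! hbad
    classical
    have hspec := Nat.find_spec hbad
    have hmin : ∀ j, j < Nat.find hbad → j ≤ n → G.dist z (q j) = G.dist w (q j) + 1 :=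
      fun j hj hjn => by
        by_contra hcon
        exact Nat.find_min hbad hj ⟨hjn, hcon⟩
    generalize Nat.find hbad = k at hspec hmin
    obtain ⟨hk, hkz⟩ := hspec
    have hk0 : k ≠ 0 := by rintro rfl; rw [q0] at hkz; exact hkz hzu
    have hkn : k ≠ n := by rintro rfl; rw [qn] at hkz; exact hkz hzv
    obtain ⟨j, rfl⟩ := Nat.exists_eq_succ_of_ne_zero hk0
    have hj := hmin j (by omega) (by omega)
    have rj := hrow _ (qI j (by omega))
    have rk := hrow _ (qI (j + 1) hk)
    have hup := dist_le_succ_of_adj hc (q (j + 1)) hwz.symm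
    simp only [dist_comm (u := q (j + 1))] at hup
    have hlow := dist_le_succ_of_adj hc z (qa j (by omega))
    simp only [Nat.succ_eq_add_one] at hk hkz hkn
    refine no_dip_in_row hc hb hk4 hwz (G.dist w u) (n - j) (fun i => q (j + i)) (by omega)
      (fun i hi => hrow _ (qI _ (by omega))) (fun i hi => qa (j + i) (by omega)) ?_
      (by simp only [Nat.add_zero]; omega) (by omega) ?_
    · intro i c hi c0 _ c2
      have h1 := qu (j + i) (by omega)
      have h2 := qd (j + (i + 2)) (by omega)
      have h3 := dist_le_succ_of_adj hc u c0
      have h4 := dist_le_succ_of_adj hc v c2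
      simp only [dist_comm (u := v)] at h4
      have h5 := hc.dist_triangle (u := u) (v := c) (w := v)
      have h6 := hrow c (by simp only [interval, Set.mem_ofPred_eq]; omega)
      omega
    · rw [show j + (n - j) = n by omega, qn, hzv, hrow v (qn ▸ qI n le_rfl)]
  have hcone : ∀ k ≤ n, G.dist x (q k) + 1 = G.dist w (q k) := by
    intro k
    induction k with
    | zero => intro _; rw [q0]; exact hxu
    | succ k ih =>
      intro hk
      obtain ⟨x', hx', hx'q⟩ := exists_isConeBase hc hb hwz (hplus _ hk)
        (fun h => hno _ h (qI _ hk))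
      have hw : G.dist w (q k) = G.dist w (q (k + 1)) := by
        rw [hrow _ (qI k (by omega)), hrow _ (qI _ hk)]
      obtain rfl := hx.eq_of_adj hc hb hk4 hwz hx' (hplus k (by omega)) (hplus _ hk)
        (ih (by omega)) hx'q (qa k (by omega)) hw
      exact hx'q
  have hxv := hcone n le_rfl
  rw [qn] at hxv
  exact hxy (hx.eq hc hb hk4 hwz hy hxv hyv)

theorem interval_comm {G : SimpleGraph V} (u v : V) : interval G u v = interval G v u := by
  ext t
  simp only [interval, Set.mem_ofPred_eq, dist_comm (u := t), dist_comm (u := u) (v := v)]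
  rw [dist_comm (v := t), dist_comm (v := t), Nat.add_comm]

theorem interval_subset_of_mem {G : SimpleGraph V} (hc : G.Connected) {u v p t : V}
    (hp : p ∈ interval G u v) (ht : t ∈ interval G p v) : t ∈ interval G u v := by
  simp only [interval, Set.mem_ofPred_eq] at *
  have h1 := hc.dist_triangle (u := u) (v := p) (w := t)
  have h2 := hc.dist_triangle (u := u) (v := t) (w := v)
  omega

/-- Geodesics between two distinct cones around `w` can be routed through the panel of `w`. -/
theorem exists_mem_panelFiber_interval {G : SimpleGraph V} (hc : G.Connected) (hb : Bridged G)
    (hk4 : K4Free G) {z w : V} (hwz : G.Adj w z) (N : ℕ) {x y u v : V}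
    (hN : G.dist w u + G.dist w v = N) (hx : IsConeBase G z w x)
    (hy : IsConeBase G z w y) (hxy : x ≠ y)
    (hzu : G.dist z u = G.dist w u + 1) (hxu : G.dist x u + 1 = G.dist w u)
    (hzv : G.dist z v = G.dist w v + 1) (hyv : G.dist y v + 1 = G.dist w v) :
    ∃ t ∈ panelFiber G z w, t ∈ interval G u v := by
  induction N using Nat.strong_induction_on generalizing x y u v with
  | _ N ih =>
  have step : ∀ {x y u v : V}, G.dist w u + G.dist w v = N → IsConeBase G z w x →
      IsConeBase G z w y → x ≠ y →
      G.dist z u = G.dist w u + 1 → G.dist x u + 1 = G.dist w u →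
      G.dist z v = G.dist w v + 1 → G.dist y v + 1 = G.dist w v →
      (∃ q ∈ interval G u v, G.dist w q < G.dist w u) →
      ∃ t ∈ panelFiber G z w, t ∈ interval G u v := by
    rintro x y u v hN hx hy hxy hzu hxu hzv hyv ⟨q, hq, hlt⟩
    obtain ⟨p, hup, hp, hpq⟩ := exists_parent_toward hc hb w q _ u rfl hlt
    have hpI : p ∈ interval G u v := by
      simp only [interval, Set.mem_ofPred_eq] at hq ⊢
      have h1 := hc.dist_triangle (u := p) (v := q) (w := v)
      have h2 := hc.dist_triangle (u := u) (v := p) (w := v)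
      have h3 := dist_eq_one_iff_adj.2 hup
      omega
    have hpw : p ∈ interval G w u := by
      simp only [interval, Set.mem_ofPred_eq, dist_eq_one_iff_adj.2 hup.symm]
      exact hp
    rcases mem_panelFiber_or_of_mem_interval hc hb hk4 hwz hx hzu hxu hpw with h | h
    · exact ⟨p, h, hpI⟩
    · obtain ⟨t, ht, htI⟩ := ih (G.dist w p + G.dist w v) (by omega) rfl hx hy hxy
        (dist_center_of_mem_interval hc hwz hzu hpw) h hzv hyv
      exact ⟨t, ht, interval_subset_of_mem hc hpI htI⟩
  by_cases h1 : ∃ q ∈ interval G u v, G.dist w q < G.dist w u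
  · exact step hN hx hy hxy hzu hxu hzv hyv h1
  by_cases h2 : ∃ q ∈ interval G v u, G.dist w q < G.dist w v
  · rw [interval_comm]
    exact step (by omega) hy hx hxy.symm hzv hyv hzu hxu h2
  push Not at h1 h2
  rw [interval_comm] at h2
  have h3 := h1 v (by simp [interval])
  have h4 := h2 u (by simp [interval])
  refine exists_mem_panelFiber_of_row hc hb hk4 hwz hx hy hxy hzu hxu hzv hyv fun t ht => ?_
  have h5 := ball_convex hc hb w ht
  have h6 := h1 t ht
  rw [le_antisymm h3 h4, max_self] at h5
  omega

/-- A geodesic entering `F` from outside meets its total boundary. -/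
theorem exists_mem_totalBoundary_interval {G : SimpleGraph V} (hc : G.Connected) {F : Set V}
    (n : ℕ) {u t : V} (h : G.dist u t = n) (hu : u ∉ F) (ht : t ∈ F) :
    ∃ b ∈ totalBoundary G F, b ∈ interval G u t := by
  induction n generalizing u with
  | zero => exact absurd (hc.dist_eq_zero_iff.1 h ▸ ht) hu
  | succ n ih =>
    obtain ⟨p, hup, hp⟩ := exists_adj_dist_eq hc h
    have hpI : p ∈ interval G u t := by
      simp only [interval, Set.mem_ofPred_eq, dist_eq_one_iff_adj.2 hup]
      omega
    by_cases hpF : p ∈ F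
    · exact ⟨p, ⟨hpF, u, hup.symm, hu⟩, hpI⟩
    · obtain ⟨b, hb, hbI⟩ := ih hp hpF
      exact ⟨b, hb, interval_subset_of_mem hc hpI hbI⟩

/-! ### The tree of branches -/

theorem branchTree_le (G : SimpleGraph V) (w : V) (S : Set V) : branchTree G w S ≤ G := by
  intro a b h
  rw [branchTree, fromRel_adj] at h
  rcases h with ⟨-, h | h⟩
  · exact h.1
  · exact h.1.symm

theorem exists_branch_walk {G : SimpleGraph V} (hc : G.Connected) {w : V} {S : Set V}
    (hS : StarshapedWrt G w S) (n : ℕ) {s c : V} (hs : s ∈ S) (hcs : c ∈ interval G w s)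
    (h : G.dist s c = n) : ∃ p : (branchTree G w S).Walk s c, p.length = n := by
  induction n generalizing s with
  | zero => obtain rfl := hc.dist_eq_zero_iff.1 h; exact ⟨.nil, rfl⟩
  | succ n ih =>
    obtain ⟨q, hsq, hq⟩ := exists_adj_dist_eq hc h
    have h1 := dist_le_succ_of_adj hc w hsq
    have h2 := hc.dist_triangle (u := w) (v := c) (w := q)
    have h3 : G.dist w c + (n + 1) = G.dist w s := by rw [← h, dist_comm (u := s)]; exact hcs
    rw [dist_comm (u := c), hq] at h2
    have hqs : q ∈ interval G w s := by
      simp only [interval, Set.mem_ofPred_eq, dist_eq_one_iff_adj.2 hsq.symm]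
      omega
    obtain ⟨p, hp⟩ := ih (hS s hs hqs)
      (by simp only [interval, Set.mem_ofPred_eq, dist_comm (u := c), hq]; omega) hq
    have hadj : (branchTree G w S).Adj s q := by
      rw [branchTree, fromRel_adj]
      refine ⟨hsq.ne, .inr ⟨hsq.symm, hS s hs hqs, hs, s, hs, hqs, ?_, ?_⟩⟩
      · simp [interval]
      · omega
    exact ⟨.cons hadj p, by simp [hp]⟩

/-- On a starshaped set, the tree distance is at most twice the graph distance. -/
theorem exists_branchTree_walk {G : SimpleGraph V} (hc : G.Connected) (hb : Bridged G) {w : V}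
    {S : Set V} (hS : StarshapedWrt G w S) {s t : V} (hs : s ∈ S) (ht : t ∈ S) :
    ∃ p : (branchTree G w S).Walk s t, p.length ≤ 2 * G.dist s t := by
  obtain ⟨c, hcs, hct, h1, h2⟩ := exists_meet hc hb w _ s t le_rfl
  obtain ⟨p, hp⟩ := exists_branch_walk hc hS _ hs hcs rfl
  obtain ⟨q, hq⟩ := exists_branch_walk hc hS _ ht hct rfl
  refine ⟨p.append q.reverse, ?_⟩
  rw [dist_comm] at h1 h2
  simp only [Walk.length_append, Walk.length_reverse, hp, hq]
  omega

/-- Reaching a vertex of a starshaped set through the entrance costs at most four times the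
distance. -/
theorem exists_branchTree_walk_from_entrance {G : SimpleGraph V} (hc : G.Connected)
    (hb : Bridged G) {w : V} {S : Set V} (hS : StarshapedWrt G w S) {u u' t : V}
    (hu' : u' ∈ mproj G u S) (hmin : ∀ a ∈ mproj G u S, G.dist w u' ≤ G.dist w a) (ht : t ∈ S) :
    ∃ p : (branchTree G w S).Walk u' t, G.dist u u' + p.length ≤ 4 * G.dist u t := by
  obtain ⟨hu'S, hproj⟩ := hu'
  have hu'I : u' ∈ interval G w u := by
    obtain ⟨c, hcu, hcu', h1, -⟩ := exists_meet hc hb w _ u u' le_rfl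
    rw [dist_comm] at h1
    have hcS := hS u' hu'S hcu'
    have h2 := hmin c ⟨hcS, fun b hbS => h1.trans (hproj b hbS)⟩
    have h3 : G.dist w c + G.dist c u' = G.dist w u' := hcu'
    obtain rfl := hc.dist_eq_zero_iff.1 (show G.dist c u' = 0 by omega)
    exact hcu
  obtain ⟨c, hcu, hct, h1, h2⟩ := exists_meet hc hb w _ u t le_rfl
  have hcS := hS t ht hct
  have hm := hproj c hcS
  have e1 : G.dist w u' + G.dist u' u = G.dist w u := hu'I
  have e2 : G.dist w c + G.dist c u = G.dist w u := hcu
  rw [dist_comm (u := u') (v := u)] at e1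
  rw [dist_comm (u := c) (v := u)] at e2 h1
  obtain ⟨r, hr, hwr, hcr⟩ := exists_shadow hc hb w u' _ u c rfl hu'I hcu (by omega)
  obtain ⟨p1, hp1⟩ := exists_branch_walk hc hS _ hu'S hr rfl
  obtain ⟨p2, hp2⟩ := exists_branchTree_walk hc hb hS (hS u' hu'S hr) hcS
  obtain ⟨p3, hp3⟩ := exists_branch_walk hc hS _ ht hct rfl
  have e3 : G.dist w r + G.dist r u' = G.dist w u' := hr
  rw [dist_comm (u := r)] at e3 hp2
  rw [dist_comm (u := c)] at h2
  refine ⟨(p1.append p2).append p3.reverse, ?_⟩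
  simp only [Walk.length_append, Walk.length_reverse]
  omega

/-- The base of a cone having `w` among its projections. -/
theorem isConeBase_of_mem_coneFiber {G : SimpleGraph V} (hc : G.Connected) (hb : Bridged G)
    (hk4 : K4Free G) {z w x u : V} (hxz : ¬ G.Adj x z) (hwz : G.Adj w z) (hwx : G.Adj w x)
    (hu : u ∈ coneFiber G z x) :
    IsConeBase G z w x ∧ G.dist z u = G.dist w u + 1 ∧ G.dist x u + 1 = G.dist w u := by
  obtain ⟨a, b, hab, hadj, hza, hzb, hxa, hxb, hm, hd⟩ := hu
  have ha : a ∈ mproj G u (closedNbhd G z) := hm ▸ .inl rfl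
  have hbm : b ∈ mproj G u (closedNbhd G z) := hm ▸ .inr rfl
  have hxne : x ≠ z := by
    rintro rfl
    have := ha.2 x (.inl rfl)
    omega
  have hz : z ∉ mproj G u (closedNbhd G z) := by
    rw [hm]
    rintro (h | h)
    · exact hza.ne h
    · exact hzb.ne h
  have hw : w = a ∨ w = b := by
    by_contra! hne
    have key : ∀ c, G.Adj z c → G.Adj x c → w ≠ c → G.Adj w c := by
      intro c hzc hxc hwc
      by_contra hn
      exact hb.2.1 ⟨w, x, c, z, hwx, hxc, hzc.symm, hwz.symm, hwc, hxne, hn, hxz⟩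
    exact hk4 ⟨z, w, a, b, hwz.symm, hza, hzb, key a hza hxa hne.1, key b hzb hxb hne.2, hadj⟩
  have hwm : w ∈ mproj G u (closedNbhd G z) := by
    rcases hw with rfl | rfl
    exacts [ha, hbm]
  have hzu : G.dist u w < G.dist u z := by
    by_contra! hle
    exact hz ⟨.inl rfl, fun c hcm => hle.trans (hwm.2 c hcm)⟩
  have hwa := le_antisymm (hwm.2 a ha.1) (ha.2 w hwm.1)
  have hz' := dist_le_succ_of_adj hc u hwz.symm
  simp only [dist_comm (u := u)] at hzu hz' hwa hd
  refine ⟨⟨hxz, hxne, hwx.symm, ?_⟩, by omega, by omega⟩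
  rcases hw with rfl | rfl
  · exact ⟨b, hxb, hadj.symm, hzb.symm⟩
  · exact ⟨a, hxa, hadj, hza.symm⟩

/-- 2cc-neighboring pairs: going through the entrances of `u` and `v` on the total
boundary of the common panel approximates the distance within a factor 4. -/
theorem stmt19 (G : SimpleGraph V) (hc : G.Connected) (hb : Bridged G) (hk4 : K4Free G)
    (z x y w u v u' v' : V)
    (hxS : x ∈ starSet G z) (hyS : y ∈ starSet G z) (hwS : w ∈ starSet G z)
    (hxz : ¬ G.Adj x z) (hyz : ¬ G.Adj y z) (hxy : x ≠ y)
    (hwz : G.Adj w z) (hwx : G.Adj w x) (hwy : G.Adj w y)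
    (hu : u ∈ coneFiber G z x) (hv : v ∈ coneFiber G z y)
    (hu'1 : u' ∈ mproj G u (totalBoundary G (panelFiber G z w)))
    (hu'2 : ∀ a ∈ mproj G u (totalBoundary G (panelFiber G z w)),
      G.dist w u' ≤ G.dist w a)
    (hv'1 : v' ∈ mproj G v (totalBoundary G (panelFiber G z w)))
    (hv'2 : ∀ a ∈ mproj G v (totalBoundary G (panelFiber G z w)),
      G.dist w v' ≤ G.dist w a) :
    G.dist u v ≤
      G.dist u u' +
        (branchTree G w (totalBoundary G (panelFiber G z w))).dist u' v' +
        G.dist v' v ∧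
    G.dist u u' +
        (branchTree G w (totalBoundary G (panelFiber G z w))).dist u' v' +
        G.dist v' v ≤ 4 * G.dist u v := by
  obtain ⟨hx, hzu, hxu⟩ := isConeBase_of_mem_coneFiber hc hb hk4 hxz hwz hwx hu
  obtain ⟨hy, hzv, hyv⟩ := isConeBase_of_mem_coneFiber hc hb hk4 hyz hwz hwy hv
  have hS := totalBoundary_starshaped hc hb hk4 hwz
  obtain ⟨t, ht, htI⟩ :=
    exists_mem_panelFiber_interval hc hb hk4 hwz _ rfl hx hy hxy hzu hxu hzv hyv
  obtain ⟨b, hbT, hbI⟩ := exists_mem_totalBoundary_interval hc _ rfl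
    (notMem_panelFiber hc hwz hx hxu) ht
  obtain ⟨p, hp⟩ := exists_branchTree_walk_from_entrance hc hb hS hu'1 hu'2 hbT
  obtain ⟨q, hq⟩ := exists_branchTree_walk_from_entrance hc hb hS hv'1 hv'2 hbT
  have hpq := dist_le (p.append q.reverse)
  rw [Walk.length_append, Walk.length_reverse] at hpq
  simp only [interval, Set.mem_ofPred_eq] at htI hbI
  constructor
  · obtain ⟨r, hr⟩ := (p.append q.reverse).reachable.exists_walk_length_eq_dist
    have h1 := dist_le (r.mapLe (branchTree_le G w _))
    rw [Walk.length_map, hr] at h1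
    have h2 := hc.dist_triangle (u := u) (v := u') (w := v)
    have h3 := hc.dist_triangle (u := u') (v := v') (w := v)
    omega
  · have h1 := hc.dist_triangle (u := b) (v := t) (w := v)
    have h2 := dist_comm (G := G) (u := v) (v := b)
    have h3 := dist_comm (G := G) (u := v) (v := v')
    omega
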